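/- Fix N ≥ 1 and indices 0 ≤ i < j < N, let a_i, a_j be the Jordan–Wigner annihilation operators on N qubits, and let a, b, c, d be real numbers. Then the Fermion-preserving Hamiltonian H_g = a · (a_i† a_i) + b · (a_j† a_j) + (c + d·i) · (a_i† a_j) + (c − d·i) · (a_j† a_i) satisfies H_g = ((a + b)/2) · 1 − (1/2) · (a · Z_i + b · Z_j) + (c/2) · (Y_i Z⋯Z Y_j + X_i Z⋯Z X_j) + (d/2) · (Y_i Z⋯Z X_j − X_i Z⋯Z Y_j). In particular, a Fermion-preserving two-mode Hamiltonian corresponds to a sum of (j−i+1)-local Pauli strings determined by only 4 real parameters. -/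

import Mathlib

open Matrix

/-- Tensor product of `N` single-qubit matrices, as a matrix indexed by bit strings. -/
noncomputable def tensorProd {N : ℕ} (M : Fin N → Matrix (Fin 2) (Fin 2) ℂ) :
    Matrix (Fin N → Fin 2) (Fin N → Fin 2) ℂ :=
  Matrix.of fun s t => ∏ k, M k (s k) (t k)

/-- Pauli `X`. -/
def pauliX : Matrix (Fin 2) (Fin 2) ℂ := !![0, 1; 1, 0]

/-- Pauli `Y`. -/
def pauliY : Matrix (Fin 2) (Fin 2) ℂ := !![0, -Complex.I; Complex.I, 0]

/-- Pauli `Z`. -/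
def pauliZ : Matrix (Fin 2) (Fin 2) ℂ := !![1, 0; 0, -1]

/-- Jordan–Wigner annihilation operator `a_j` on `N` qubits: `Z` on slots before `j`,
`(X + iY)/2` on slot `j`, identity after. -/
noncomputable def aOp (N : ℕ) (j : Fin N) : Matrix (Fin N → Fin 2) (Fin N → Fin 2) ℂ :=
  tensorProd fun k =>
    if k < j then pauliZ
    else if k = j then (2 : ℂ)⁻¹ • (pauliX + Complex.I • pauliY)
    else 1

/-- `P_j`: single-qubit matrix `P` in slot `j`, identity elsewhere. -/
noncomputable def singleSite (N : ℕ) (j : Fin N) (P : Matrix (Fin 2) (Fin 2) ℂ) :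
    Matrix (Fin N → Fin 2) (Fin N → Fin 2) ℂ :=
  tensorProd fun k => if k = j then P else 1

/-- `P_i Z⋯Z Q_j`: `P` in slot `i`, Pauli `Z` strictly between `i` and `j`, `Q` in
slot `j`, identity elsewhere. -/
noncomputable def pauliString (N : ℕ) (i j : Fin N) (P Q : Matrix (Fin 2) (Fin 2) ℂ) :
    Matrix (Fin N → Fin 2) (Fin N → Fin 2) ℂ :=
  tensorProd fun k =>
    if k = i then P else if k = j then Q else if i < k ∧ k < j then pauliZ else 1

theorem tensorProd_mul_aux {N : ℕ} (A B : Fin N → Matrix (Fin 2) (Fin 2) ℂ) :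
    tensorProd A * tensorProd B = tensorProd fun k => A k * B k := by
  ext s t
  simp only [tensorProd, Matrix.mul_apply, Matrix.of_apply, ← Finset.prod_mul_distrib]
  rw [Finset.prod_univ_sum, Fintype.piFinset_univ]

theorem tensorProd_conjTranspose_aux {N : ℕ} (A : Fin N → Matrix (Fin 2) (Fin 2) ℂ) :
    (tensorProd A)ᴴ = tensorProd fun k => (A k)ᴴ := by
  ext s t
  simp [tensorProd, Matrix.conjTranspose_apply]

theorem tensorProd_one_aux {N : ℕ} :
    (1 : Matrix (Fin N → Fin 2) (Fin N → Fin 2) ℂ) = tensorProd fun _ => 1 := by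
  ext s t
  simp only [tensorProd, Matrix.of_apply, Matrix.one_apply, Finset.prod_ite_zero,
    Finset.prod_const_one, Finset.mem_univ, true_imp_iff, funext_iff]

theorem lower_aux : (2 : ℂ)⁻¹ • (pauliX + Complex.I • pauliY) = !![0, 1; 0, 0] := by
  ext x y
  fin_cases x <;> fin_cases y <;> simp [pauliX, pauliY] <;> norm_num

theorem pauliZ_sq_aux : pauliZᴴ * pauliZ = 1 := by
  ext x y
  fin_cases x <;> fin_cases y <;> simp [pauliZ, Matrix.mul_apply, Fin.sum_univ_two]

theorem pauliZ_herm_aux : pauliZᴴ = pauliZ := by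
  ext x y
  fin_cases x <;> fin_cases y <;> simp [pauliZ]

theorem lowZ_aux : (!![0, 1; 0, 0] : Matrix (Fin 2) (Fin 2) ℂ)ᴴ * pauliZ = !![0, 0; 1, 0] := by
  ext x y
  fin_cases x <;> fin_cases y <;> simp [pauliZ, Matrix.mul_apply, Fin.sum_univ_two]

theorem Zlow_aux : pauliZᴴ * (!![0, 1; 0, 0] : Matrix (Fin 2) (Fin 2) ℂ) = !![0, 1; 0, 0] := by
  ext x y
  fin_cases x <;> fin_cases y <;> simp [pauliZ, Matrix.mul_apply, Fin.sum_univ_two]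

theorem lowH_aux : (!![0, 1; 0, 0] : Matrix (Fin 2) (Fin 2) ℂ)ᴴ = !![0, 0; 1, 0] := by
  ext x y
  fin_cases x <;> fin_cases y <;> simp

theorem lowlow_aux : (!![0, 1; 0, 0] : Matrix (Fin 2) (Fin 2) ℂ)ᴴ * !![0, 1; 0, 0]
    = !![0, 0; 0, 1] := by
  ext x y
  fin_cases x <;> fin_cases y <;> simp [Matrix.mul_apply, Fin.sum_univ_two]

theorem number_aux (N : ℕ) (i : Fin N) :
    (aOp N i)ᴴ * aOp N i = singleSite N i !![0, 0; 0, 1] := by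
  rw [aOp, tensorProd_conjTranspose_aux, tensorProd_mul_aux, singleSite, lower_aux]
  congr 1
  funext k
  rcases lt_trichotomy k i with h | h | h
  · simp only [h, h.ne, if_true, if_false, pauliZ_sq_aux]
  · subst h
    simp only [lt_irrefl, if_true, if_false, lowlow_aux]
  · simp [h.not_gt, h.ne']

theorem hop_aux (N : ℕ) (i j : Fin N) (hij : i < j) :
    (aOp N i)ᴴ * aOp N j = pauliString N i j !![0, 0; 1, 0] !![0, 1; 0, 0] := by
  rw [aOp, aOp, tensorProd_conjTranspose_aux, tensorProd_mul_aux, pauliString, lower_aux]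
  congr 1
  funext k
  rcases lt_trichotomy k i with h | h | h
  · simp only [h, h.ne, (h.trans hij), (h.trans hij).ne, h.not_gt, if_true, if_false,
      false_and, pauliZ_sq_aux]
  · subst h
    simp only [lt_irrefl, hij, if_true, if_false, lowZ_aux]
  · rcases lt_trichotomy k j with h' | h' | h'
    · simp [h, h', h.not_gt, h.ne', h'.ne]
    · subst h'
      simp [h.not_gt, h.ne']
    · simp [h.not_gt, h.ne', h'.not_gt, h'.ne']

theorem hop'_aux (N : ℕ) (i j : Fin N) (hij : i < j) :
    (aOp N j)ᴴ * aOp N i = pauliString N i j !![0, 1; 0, 0] !![0, 0; 1, 0] := by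
  rw [aOp, aOp, tensorProd_conjTranspose_aux, tensorProd_mul_aux, pauliString, lower_aux]
  congr 1
  funext k
  rcases lt_trichotomy k i with h | h | h
  · simp only [h, h.ne, (h.trans hij), (h.trans hij).ne, h.not_gt, if_true, if_false,
      false_and, pauliZ_sq_aux]
  · subst h
    simp only [lt_irrefl, hij, if_true, if_false, Zlow_aux]
  · rcases lt_trichotomy k j with h' | h' | h'
    · simp [h, h', h.not_gt, h.ne', h'.ne, pauliZ_herm_aux]
    · subst h'
      simp only [lt_irrefl, h.not_gt, h.ne', if_true, if_false, mul_one, lowH_aux]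
    · simp [h.not_gt, h.ne', h'.not_gt, h'.ne']

theorem singleSite_apply_aux (N : ℕ) (i : Fin N) (s t : Fin N → Fin 2) :
    ∃ r : ℂ, ∀ P, singleSite N i P s t = P (s i) (t i) * r := by
  refine ⟨∏ k ∈ Finset.univ.erase i, (1 : Matrix (Fin 2) (Fin 2) ℂ) (s k) (t k), fun P => ?_⟩
  rw [singleSite, tensorProd, Matrix.of_apply, ← Finset.mul_prod_erase _ _ (Finset.mem_univ i),
    if_pos rfl]
  congr 1
  refine Finset.prod_congr rfl fun k hk => ?_
  rw [if_neg (Finset.ne_of_mem_erase hk)]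

theorem pauliString_apply_aux (N : ℕ) (i j : Fin N) (hij : i < j) (s t : Fin N → Fin 2) :
    ∃ r : ℂ, ∀ P Q, pauliString N i j P Q s t = P (s i) (t i) * (Q (s j) (t j) * r) := by
  refine ⟨∏ k ∈ (Finset.univ.erase i).erase j,
    (if i < k ∧ k < j then pauliZ else 1 : Matrix (Fin 2) (Fin 2) ℂ) (s k) (t k), fun P Q => ?_⟩
  rw [pauliString, tensorProd, Matrix.of_apply, ← Finset.mul_prod_erase _ _ (Finset.mem_univ i),
    ← Finset.mul_prod_erase _ _ (Finset.mem_erase.2 ⟨hij.ne', Finset.mem_univ j⟩),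
    if_pos rfl, if_neg hij.ne', if_pos rfl]
  congr 2
  refine Finset.prod_congr rfl fun k hk => ?_
  simp only [Finset.mem_erase] at hk
  rw [if_neg hk.2.1, if_neg hk.1]

theorem one_eq_singleSite_aux (N : ℕ) (i : Fin N) :
    (1 : Matrix (Fin N → Fin 2) (Fin N → Fin 2) ℂ) = singleSite N i 1 := by
  rw [tensorProd_one_aux, singleSite]
  simp

theorem number_form_aux (N : ℕ) (i : Fin N) :
    singleSite N i !![0, 0; 0, 1] = (2 : ℂ)⁻¹ • (1 - singleSite N i pauliZ) := by
  rw [one_eq_singleSite_aux N i]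
  ext s t
  obtain ⟨r, hr⟩ := singleSite_apply_aux N i s t
  simp only [Matrix.smul_apply, Matrix.sub_apply, hr, smul_eq_mul]
  generalize s i = x
  generalize t i = y
  fin_cases x <;> fin_cases y <;> simp [pauliZ] <;> ring

/-- The Fermion-preserving two-mode Hamiltonian
`H_g = a a_i† a_i + b a_j† a_j + (c+di) a_i† a_j + (c−di) a_j† a_i` equals
`((a+b)/2)·1 − (1/2)(a Z_i + b Z_j) + (c/2)(Y_i Z⋯Z Y_j + X_i Z⋯Z X_j)
 + (d/2)(Y_i Z⋯Z X_j − X_i Z⋯Z Y_j)`. -/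
theorem fermion_preserving_hamiltonian_pauli_form
    (N : ℕ) (hN : 1 ≤ N) (i j : Fin N) (hij : i < j) (a b c d : ℝ) :
    (a : ℂ) • ((aOp N i)ᴴ * aOp N i) + (b : ℂ) • ((aOp N j)ᴴ * aOp N j)
        + ((c : ℂ) + (d : ℂ) * Complex.I) • ((aOp N i)ᴴ * aOp N j)
        + ((c : ℂ) - (d : ℂ) * Complex.I) • ((aOp N j)ᴴ * aOp N i)
      = (((a : ℂ) + (b : ℂ)) / 2) • (1 : Matrix (Fin N → Fin 2) (Fin N → Fin 2) ℂ)
        - (2 : ℂ)⁻¹ • ((a : ℂ) • singleSite N i pauliZ + (b : ℂ) • singleSite N j pauliZ)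
        + ((c : ℂ) / 2) • (pauliString N i j pauliY pauliY + pauliString N i j pauliX pauliX)
        + ((d : ℂ) / 2) • (pauliString N i j pauliY pauliX - pauliString N i j pauliX pauliY) := by
  rw [number_aux, number_aux, hop_aux N i j hij, hop'_aux N i j hij, number_form_aux,
    number_form_aux]
  ext s t
  obtain ⟨r, hr⟩ := pauliString_apply_aux N i j hij s t
  simp only [Matrix.smul_apply, Matrix.sub_apply, Matrix.add_apply, hr, smul_eq_mul]
  generalize s i = x
  generalize t i = y
  generalize s j = z
  generalize t j = w
  have hI : Complex.I * Complex.I = -1 := Complex.I_mul_I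
  fin_cases x <;> fin_cases y <;> fin_cases z <;> fin_cases w <;>
    simp [pauliX, pauliY] <;> 
    first
    | ring1
    | linear_combination (c / 2 * r : ℂ) * hI
    | linear_combination (-c / 2 * r : ℂ) * hI
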